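/- arXiv:2110.08891 — 2 statements merged into one kernel-verified Lean document; each statement's English description precedes it below -/
import Mathlib

section
/- Let R be a commutative ring, r ∈ R, and C a cochain complex of R-modules indexed by ℤ such that multiplication by r is injective on each C^n. Fix i ∈ ℤ and suppose H^i(C) has finite r-torsion: there exists k₀ ∈ ℕ such that every x ∈ H^i(C) with r^k·x = 0 for some k ≥ 1 already satisfies r^{k₀}·x = 0. Then for every n ≥ 1 and every m ≥ n + k₀, the image of the natural map H^{i-1}(C/r^m C) → H^{i-1}(C/r^n C) equals the image of the map H^{i-1}(C) → H^{i-1}(C/r^n C) induced by the projection; in particular, the images of the maps H^{i-1}(C/r^m C) → H^{i-1}(C/r^n C) are the same for all m ≥ n + k₀, so the inverse system (H^{i-1}(C/r^n C))_{n∈ℕ} satisfies the Mittag-Leffler condition (eventual stabilization of images). -/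
/-!
Statement 2: if `H^i(C)` has finite `r`-torsion (with torsion exponent `k₀`), then for
`n ≥ 1` and `m ≥ n + k₀` the image of `H^{i-1}(C/r^m C) → H^{i-1}(C/r^n C)` equals the
image of `H^{i-1}(C) → H^{i-1}(C/r^n C)`; in particular the inverse system
`(H^{i-1}(C/r^n C))_n` is Mittag-Leffler.

Degrees are indexed by a base integer `j`, with `i - 1 = j + 1` (so `i = j + 2`):
`H^{i-1}` is the cohomology in degree `j + 1` and `H^i` the cohomology in degree `j + 1 + 1`.
-/

section Setup

variable {R : Type} [CommRing R]

/-- The submodule `r·M` of `r`-multiples of a module `M`. -/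
def rMul (r : R) (M : Type) [AddCommGroup M] [Module R M] : Submodule R M :=
  LinearMap.range (r • (LinearMap.id : M →ₗ[R] M))

variable (C : ℤ → Type) [∀ n, AddCommGroup (C n)] [∀ n, Module R (C n)]
variable (d : ∀ n : ℤ, C n →ₗ[R] C (n + 1)) (r : R)

/-- The components of the quotient complex `C/rC`. -/
abbrev QuotCx (n : ℤ) : Type := C n ⧸ rMul r (C n)

/-- The differential of the quotient complex `C/rC`. -/
def dQ (n : ℤ) : QuotCx C r n →ₗ[R] QuotCx C r (n + 1) :=
  Submodule.mapQ _ _ (d n) (by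
    intro x hx
    obtain ⟨y, rfl⟩ := LinearMap.mem_range.mp hx
    exact Submodule.mem_comap.mpr (LinearMap.mem_range.mpr ⟨d n y, by simp⟩))

/-- The cohomology of a `ℤ`-indexed cochain complex in degree `n + 1`. -/
abbrev Hcoh (X : ℤ → Type) [∀ n, AddCommGroup (X n)] [∀ n, Module R (X n)]
    (D : ∀ n : ℤ, X n →ₗ[R] X (n + 1)) (n : ℤ) : Type :=
  LinearMap.ker (D (n + 1)) ⧸
    Submodule.comap (LinearMap.ker (D (n + 1))).subtype (LinearMap.range (D n))

/-- The image of a cocycle of `C` in the cocycles of `C/rC`, under the levelwise projection. -/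
def kerProj (n : ℤ) (x : LinearMap.ker (d (n + 1))) :
    LinearMap.ker (dQ C d r (n + 1)) :=
  ⟨Submodule.Quotient.mk x.1, by
    have hx : d (n + 1) x.1 = 0 := LinearMap.mem_ker.mp x.2
    rw [LinearMap.mem_ker]
    show Submodule.mapQ _ _ _ _ _ = 0
    rw [Submodule.mapQ_apply, hx, Submodule.Quotient.mk_zero]⟩

/-- The natural levelwise quotient map `C/r^m C → C/r^n C` for `n ≤ m`. -/
def redMapPow (n m : ℕ) (hnm : n ≤ m) (dg : ℤ) :
    QuotCx C (r ^ m) dg →ₗ[R] QuotCx C (r ^ n) dg :=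
  Submodule.mapQ _ _ LinearMap.id (by
    intro x hx
    obtain ⟨y, rfl⟩ := LinearMap.mem_range.mp hx
    refine Submodule.mem_comap.mpr (LinearMap.mem_range.mpr ⟨r ^ (m - n) • y, ?_⟩)
    simp only [LinearMap.smul_apply, LinearMap.id_apply, smul_smul]
    rw [← pow_add, Nat.add_sub_cancel' hnm])

/-- The levelwise quotient `C/r^m C → C/r^n C` maps cocycles to cocycles. -/
def redKerPow (n m : ℕ) (hnm : n ≤ m) (dg : ℤ)
    (x : LinearMap.ker (dQ C d (r ^ m) (dg + 1))) :
    LinearMap.ker (dQ C d (r ^ n) (dg + 1)) :=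
  ⟨redMapPow C r n m hnm (dg + 1) x.1, by
    obtain ⟨y, hy⟩ := Submodule.Quotient.mk_surjective _ x.1
    have hx : dQ C d (r ^ m) (dg + 1) x.1 = 0 := LinearMap.mem_ker.mp x.2
    rw [← hy] at hx
    rw [LinearMap.mem_ker, ← hy]
    have h1 : redMapPow C r n m hnm (dg + 1) (Submodule.Quotient.mk y) =
        Submodule.Quotient.mk y := by
      show Submodule.mapQ _ _ _ _ _ = _
      rw [Submodule.mapQ_apply, LinearMap.id_apply]
    have h2 : dQ C d (r ^ m) (dg + 1) (Submodule.Quotient.mk y) =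
        Submodule.Quotient.mk (d (dg + 1) y) := by
      show Submodule.mapQ _ _ _ _ _ = _
      rw [Submodule.mapQ_apply]
    have h3 : dQ C d (r ^ n) (dg + 1) (Submodule.Quotient.mk y) =
        Submodule.Quotient.mk (d (dg + 1) y) := by
      show Submodule.mapQ _ _ _ _ _ = _
      rw [Submodule.mapQ_apply]
    rw [h1, h3]
    rw [h2, Submodule.Quotient.mk_eq_zero] at hx
    obtain ⟨w, hw⟩ := LinearMap.mem_range.mp hx
    rw [Submodule.Quotient.mk_eq_zero]
    refine LinearMap.mem_range.mpr ⟨r ^ (m - n) • w, ?_⟩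
    simp only [LinearMap.smul_apply, LinearMap.id_apply, smul_smul] at hw ⊢
    rw [← pow_add, Nat.add_sub_cancel' hnm, hw]⟩

end Setup

section Helpers

variable {R : Type} [CommRing R]

theorem mem_rMul {M : Type} [AddCommGroup M] [Module R M] {r : R} {x : M} :
    x ∈ rMul r M ↔ ∃ y : M, r • y = x := by
  simp [rMul, LinearMap.mem_range]

variable (C : ℤ → Type) [∀ n, AddCommGroup (C n)] [∀ n, Module R (C n)]
variable (d : ∀ n : ℤ, C n →ₗ[R] C (n + 1)) (r : R)

/-- The map `H^{j+1}(C) → H^{j+1}(C/rC)` induced by the projection. -/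
def hcohProj (j : ℤ) : Hcoh C d j →ₗ[R] Hcoh (QuotCx C r) (dQ C d r) j :=
  Submodule.mapQ _ _
    { toFun := kerProj C d r j
      map_add' := fun _ _ => rfl
      map_smul' := fun _ _ => rfl } (by
    rintro x ⟨y, hy⟩
    exact ⟨Submodule.Quotient.mk y, congrArg Submodule.Quotient.mk hy⟩)

/-- The natural map `H^{j+1}(C/r^m C) → H^{j+1}(C/r^n C)` for `n ≤ m`. -/
def hcohRed (n m : ℕ) (hnm : n ≤ m) (j : ℤ) :
    Hcoh (QuotCx C (r ^ m)) (dQ C d (r ^ m)) j →ₗ[R]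
      Hcoh (QuotCx C (r ^ n)) (dQ C d (r ^ n)) j :=
  Submodule.mapQ _ _
    { toFun := redKerPow C d r n m hnm j
      map_add' := fun _ _ => Subtype.ext (map_add (redMapPow C r n m hnm (j + 1)) _ _)
      map_smul' := fun _ _ => Subtype.ext (map_smul (redMapPow C r n m hnm (j + 1)) _ _) } (by
    rintro x ⟨y, hy⟩
    obtain ⟨y, rfl⟩ := Submodule.Quotient.mk_surjective _ y
    exact ⟨Submodule.Quotient.mk y, congrArg (redMapPow C r n m hnm (j + 1)) hy⟩)

theorem hcohRed_comp_hcohProj (n m : ℕ) (hnm : n ≤ m) (j : ℤ) :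
    hcohRed C d r n m hnm j ∘ₗ hcohProj C d (r ^ m) j = hcohProj C d (r ^ n) j := by
  refine LinearMap.ext fun x => ?_
  obtain ⟨x, rfl⟩ := Submodule.Quotient.mk_surjective _ x
  rfl

variable {C d r}

theorem eq_zero_of_pow_smul_eq_zero {M : Type} [AddCommGroup M] [Module R M]
    (hr : ∀ x : M, r • x = 0 → x = 0) (k : ℕ) {x : M} (hx : r ^ k • x = 0) : x = 0 := by
  induction k with
  | zero => simpa using hx
  | succ k ih => exact ih (hr _ (by rwa [smul_smul, ← pow_succ']))

/-- A cochain that is a cocycle modulo `r ^ m` can be corrected by a multiple of `r ^ (m - k₀)`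
to a cocycle, if `k₀` bounds the `r`-torsion exponent of the next cohomology module. -/
theorem exists_sub_pow_smul_mem_ker
    (hdd : ∀ (n : ℤ) (x : C n), d (n + 1) (d n x) = 0)
    (hr : ∀ (n : ℤ) (x : C n), r • x = 0 → x = 0)
    {j : ℤ} {k₀ m : ℕ} (hm : 1 ≤ m) (hk : k₀ ≤ m)
    (htor : ∀ x : Hcoh C d (j + 1), (∃ k : ℕ, 1 ≤ k ∧ r ^ k • x = 0) → r ^ k₀ • x = 0)
    {y : C (j + 1)} (hy : d (j + 1) y ∈ rMul (r ^ m) (C (j + 1 + 1))) :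
    ∃ v : C (j + 1), y - r ^ (m - k₀) • v ∈ LinearMap.ker (d (j + 1)) := by
  obtain ⟨w, hw⟩ := mem_rMul.mp hy
  have hdw : d (j + 1 + 1) w = 0 :=
    eq_zero_of_pow_smul_eq_zero (hr _) m (by rw [← map_smul, hw, hdd])
  have hzero := htor (Submodule.Quotient.mk ⟨w, hdw⟩) ⟨m, hm, by
    rw [← Submodule.Quotient.mk_smul, Submodule.Quotient.mk_eq_zero]
    exact ⟨y, hw.symm⟩⟩
  rw [← Submodule.Quotient.mk_smul, Submodule.Quotient.mk_eq_zero] at hzero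
  obtain ⟨v, hv⟩ := hzero
  replace hv : d (j + 1) v = r ^ k₀ • w := hv
  refine ⟨v, ?_⟩
  rw [LinearMap.mem_ker, map_sub, map_smul, hv, smul_smul, ← pow_add, Nat.sub_add_cancel hk, hw,
    sub_self]

theorem range_hcohRed_eq_range_hcohProj
    (hdd : ∀ (n : ℤ) (x : C n), d (n + 1) (d n x) = 0)
    (hr : ∀ (n : ℤ) (x : C n), r • x = 0 → x = 0)
    {j : ℤ} {k₀ n m : ℕ} (hn : 1 ≤ n) (hm : n + k₀ ≤ m)
    (htor : ∀ x : Hcoh C d (j + 1), (∃ k : ℕ, 1 ≤ k ∧ r ^ k • x = 0) → r ^ k₀ • x = 0) :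
    LinearMap.range (hcohRed C d r n m ((Nat.le_add_right n k₀).trans hm) j) =
      LinearMap.range (hcohProj C d (r ^ n) j) := by
  apply le_antisymm
  · rintro _ ⟨x, rfl⟩
    obtain ⟨⟨x, hx⟩, rfl⟩ := Submodule.Quotient.mk_surjective _ x
    obtain ⟨y, rfl⟩ := Submodule.Quotient.mk_surjective _ x
    obtain ⟨v, hv⟩ := exists_sub_pow_smul_mem_ker hdd hr (by omega) (by omega) htor
      ((Submodule.Quotient.mk_eq_zero _).mp hx)
    refine ⟨Submodule.Quotient.mk ⟨_, hv⟩, congrArg Submodule.Quotient.mk (Subtype.ext ?_)⟩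
    refine (Submodule.Quotient.eq _).mpr (mem_rMul.mpr ⟨-(r ^ (m - k₀ - n) • v), ?_⟩)
    rw [smul_neg, smul_smul, ← pow_add, show n + (m - k₀ - n) = m - k₀ by omega]
    simp
  · rw [← hcohRed_comp_hcohProj C d r n m ((Nat.le_add_right n k₀).trans hm) j]
    exact LinearMap.range_comp_le_range _ _

end Helpers

/-- Let `C` be a cochain complex of `R`-modules on which multiplication by
`r` is injective in every degree, and suppose `H^i(C)` (here realized in degree `j + 1 + 1`)
has finite `r`-torsion with exponent `k₀`: any element killed by some positive power of `r` is
killed by `r ^ k₀`.  Then for every `n ≥ 1` and every `m ≥ n + k₀`, the image of the natural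
map `H^{i-1}(C/r^m C) → H^{i-1}(C/r^n C)` equals the image of the map
`H^{i-1}(C) → H^{i-1}(C/r^n C)` induced by the projection; in particular these images agree
for all `m ≥ n + k₀`, so the inverse system `(H^{i-1}(C/r^n C))_n` satisfies the
Mittag-Leffler condition. -/
theorem mittag_leffler_of_finite_torsion
    {R : Type} [CommRing R]
    (C : ℤ → Type) [∀ n, AddCommGroup (C n)] [∀ n, Module R (C n)]
    (d : ∀ n : ℤ, C n →ₗ[R] C (n + 1))
    (hdd : ∀ (n : ℤ) (x : C n), d (n + 1) (d n x) = 0)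
    (r : R)
    (hr : ∀ (n : ℤ) (x : C n), r • x = 0 → x = 0)
    (j : ℤ) (k₀ : ℕ)
    (htor : ∀ x : Hcoh C d (j + 1), (∃ k : ℕ, 1 ≤ k ∧ r ^ k • x = 0) → r ^ k₀ • x = 0) :
    ∀ (n : ℕ) (_hn : 1 ≤ n),
      ∃ π : Hcoh C d j →ₗ[R] Hcoh (QuotCx C (r ^ n)) (dQ C d (r ^ n)) j,
        (∀ x : LinearMap.ker (d (j + 1)),
            π (Submodule.Quotient.mk x) = Submodule.Quotient.mk (kerProj C d (r ^ n) j x)) ∧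
        ∀ (m : ℕ) (hm : n + k₀ ≤ m),
          ∃ ρ : Hcoh (QuotCx C (r ^ m)) (dQ C d (r ^ m)) j →ₗ[R]
              Hcoh (QuotCx C (r ^ n)) (dQ C d (r ^ n)) j,
            (∀ x : LinearMap.ker (dQ C d (r ^ m) (j + 1)),
                ρ (Submodule.Quotient.mk x) =
                  Submodule.Quotient.mk
                    (redKerPow C d r n m ((Nat.le_add_right n k₀).trans hm) j x)) ∧
            LinearMap.range ρ = LinearMap.range π := by
  intro n hn
  exact ⟨hcohProj C d (r ^ n) j, fun _ => rfl, fun m hm =>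
    ⟨hcohRed C d r n m ((Nat.le_add_right n k₀).trans hm) j, fun _ => rfl,
      range_hcohRed_eq_range_hcohProj hdd hr hn hm htor⟩⟩
end

section
/- Choose positive real numbers a, b, c with a > c and b > c. In ℝ³ set U := (−b, ∞) × (−a, a) × (−a, a), l := {(x, 0, 0) : x ≥ 0}, and V := (−c, ∞) × (−c, c) × (−c, c). Let ψ : U ∖ l → ℝ be a smooth function such that: ψ ≥ 0 everywhere; ψ(p) = 0 for every p ∈ U ∖ V; ∂ψ/∂x ≥ 0 everywhere on U ∖ l; and ψ(p_k) → +∞ for every sequence p_k in U ∖ l converging to a point of l. Then the map G : U ∖ l → ℝ³ defined by G(x, y, z) := (x + ψ(x, y, z), y, z) is a bijection of U ∖ l onto U, is smooth, and its inverse is smooth; in particular G is a diffeomorphism from U ∖ l onto U preserving the second and third coordinates and equal to the identity on U ∖ V. -/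
open Set

/-- The box `(-b, ∞) × (-a, a) × (-a, a)` in `ℝ³`. -/
def U3 (a b : ℝ) : Set (ℝ × ℝ × ℝ) := Ioi (-b) ×ˢ (Ioo (-a) a ×ˢ Ioo (-a) a)

/-- The ray `l = {(x, 0, 0) : x ≥ 0}` in `ℝ³`. -/
def ray3 : Set (ℝ × ℝ × ℝ) := {p | 0 ≤ p.1 ∧ p.2.1 = 0 ∧ p.2.2 = 0}

/-- The box `(-c, ∞) × (-c, c) × (-c, c)` in `ℝ³`. -/
def V3 (c : ℝ) : Set (ℝ × ℝ × ℝ) := Ioi (-c) ×ˢ (Ioo (-c) c ×ˢ Ioo (-c) c)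

/-- The sliding map `(x, y, z) ↦ (x + ψ(x, y, z), y, z)`. -/
def slide (ψ : ℝ × ℝ × ℝ → ℝ) (p : ℝ × ℝ × ℝ) : ℝ × ℝ × ℝ :=
  (p.1 + ψ p, p.2.1, p.2.2)

open Filter Topology

/-- A `C^n` map with invertible derivative at every point of an open set on which it is injective
has a `C^n` inverse. -/
theorem contDiffOn_of_leftInvOn_of_injective_fderiv {E : Type*} [NormedAddCommGroup E]
    [NormedSpace ℝ E] [FiniteDimensional ℝ E] {f g : E → E} {s t : Set E} {n : WithTop ℕ∞}
    (hn : n ≠ 0) (hs : IsOpen s) (hf : ContDiffOn ℝ n f s) (hgs : MapsTo g t s)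
    (hfg : RightInvOn g f t) (hgf : LeftInvOn g f s)
    (hf' : ∀ x ∈ s, Function.Injective (fderiv ℝ f x)) : ContDiffOn ℝ n g t := by
  have : CompleteSpace E := FiniteDimensional.complete ℝ E
  intro q hq
  have hp : g q ∈ s := hgs hq
  have hfp : ContDiffAt ℝ n f (g q) := hf.contDiffAt (hs.mem_nhds hp)
  let e : E ≃L[ℝ] E := (LinearEquiv.ofInjectiveEndo (fderiv ℝ f (g q) : E →ₗ[ℝ] E)
    (hf' _ hp)).toContinuousLinearEquiv
  have he : HasFDerivAt f (e : E →L[ℝ] E) (g q) := by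
    have he_coe : (e : E →L[ℝ] E) = fderiv ℝ f (g q) := by ext; rfl
    exact he_coe ▸ (hfp.differentiableAt hn).hasFDerivAt
  have hstrict := hfp.hasStrictFDerivAt' he hn
  have hinv : ContDiffAt ℝ n (hstrict.localInverse f e (g q)) (f (g q)) :=
    hfp.to_localInverse he hn
  have hmem : ∀ᶠ y in 𝓝 (f (g q)), hstrict.localInverse f e (g q) y ∈ s :=
    hstrict.localInverse_tendsto (hs.mem_nhds hp)
  have heq : g =ᶠ[𝓝 (f (g q))] hstrict.localInverse f e (g q) := by
    filter_upwards [hmem, hstrict.eventually_right_inverse] with y hy hfy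
    rw [← hgf hy, hfy]
  have hg := hinv.congr_of_eventuallyEq heq
  rw [hfg hq] at hg
  exact hg.contDiffWithinAt

theorem isOpen_U3 (a b : ℝ) : IsOpen (U3 a b) :=
  isOpen_Ioi.prod (isOpen_Ioo.prod isOpen_Ioo)

theorem isClosed_ray3 : IsClosed ray3 :=
  (isClosed_le continuous_const continuous_fst).inter
    ((isClosed_eq (by fun_prop) continuous_const).inter
      (isClosed_eq (by fun_prop) continuous_const))

theorem isOpen_U3_diff_ray3 (a b : ℝ) : IsOpen (U3 a b \ ray3) :=
  (isOpen_U3 a b).sdiff isClosed_ray3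

theorem ray3_subset_V3 {c : ℝ} (hc : 0 < c) : ray3 ⊆ V3 c := by
  rintro ⟨x, y, z⟩ ⟨hx, hy, hz⟩
  simp only at hx hy hz
  subst hy hz
  refine ⟨?_, ⟨?_, ?_⟩, ⟨?_, ?_⟩⟩ <;> simp only [mem_Ioi] <;> linarith

/-- The set `U ∖ l` is closed under decreasing the first coordinate within `U`. -/
theorem mem_U3_diff_ray3_of_le {a b x x' : ℝ} {w : ℝ × ℝ} (h : (x, w) ∈ U3 a b \ ray3)
    (hx' : -b < x') (hle : x' ≤ x) : (x', w) ∈ U3 a b \ ray3 :=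
  ⟨⟨hx', h.1.2⟩, fun hr => h.2 ⟨hr.1.trans hle, hr.2⟩⟩

section Slide

variable {a b : ℝ} {ψ : ℝ × ℝ × ℝ → ℝ}

theorem hasFDerivAt_slide {p : ℝ × ℝ × ℝ} (h : DifferentiableAt ℝ ψ p) :
    HasFDerivAt (slide ψ) ((ContinuousLinearMap.fst ℝ ℝ (ℝ × ℝ) + fderiv ℝ ψ p).prod
      (ContinuousLinearMap.snd ℝ ℝ (ℝ × ℝ))) p :=
  (hasFDerivAt_fst.add h.hasFDerivAt).prodMk hasFDerivAt_snd

theorem injective_fderiv_slide {p : ℝ × ℝ × ℝ} (h : DifferentiableAt ℝ ψ p)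
    (hpos : 0 ≤ fderiv ℝ ψ p (1, 0, 0)) : Function.Injective (fderiv ℝ (slide ψ) p) := by
  rw [(hasFDerivAt_slide h).fderiv, injective_iff_map_eq_zero]
  rintro ⟨t, w⟩ hv
  simp only [ContinuousLinearMap.prod_apply, add_apply,
    ContinuousLinearMap.coe_fst', ContinuousLinearMap.coe_snd', Prod.mk_eq_zero] at hv
  obtain ⟨h1, rfl⟩ := hv
  have ht : ((t, 0) : ℝ × ℝ × ℝ) = t • (1, 0, 0) := by ext <;> simp
  rw [ht, map_smul, smul_eq_mul] at h1
  have h2 : t * (1 + fderiv ℝ ψ p (1, 0, 0)) = 0 := by linarith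
  rcases mul_eq_zero.1 h2 with h3 | h3
  · simp [h3]
  · linarith

/-- Along each line parallel to the first axis, the first coordinate of the sliding map is strictly
increasing. -/
theorem slide_fst_lt_of_lt (hψ : DifferentiableOn ℝ ψ (U3 a b \ ray3))
    (hmono : ∀ p ∈ U3 a b \ ray3, 0 ≤ fderiv ℝ ψ p (1, 0, 0)) {x x' : ℝ} {w : ℝ × ℝ}
    (hx : (x, w) ∈ U3 a b \ ray3) (hx' : (x', w) ∈ U3 a b \ ray3) (hlt : x < x') :
    (slide ψ (x, w)).1 < (slide ψ (x', w)).1 := by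
  have hmem : ∀ t ∈ Icc x x', (t, w) ∈ U3 a b \ ray3 := fun t ht =>
    mem_U3_diff_ray3_of_le hx' (lt_of_lt_of_le hx.1.1 ht.1) ht.2
  have hderiv : ∀ t ∈ Icc x x',
      HasDerivAt (fun t => ψ (t, w)) (fderiv ℝ ψ (t, w) (1, 0, 0)) t := fun t ht =>
    ((hψ.differentiableAt ((isOpen_U3_diff_ray3 a b).mem_nhds
      (hmem t ht))).hasFDerivAt).comp_hasDerivAt t
        ((hasDerivAt_id t).prodMk (hasDerivAt_const t w))
  have hψmono : MonotoneOn (fun t => ψ (t, w)) (Icc x x') := by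
    refine monotoneOn_of_deriv_nonneg (convex_Icc x x')
      (fun t ht => (hderiv t ht).continuousAt.continuousWithinAt)
      (fun t ht => (hderiv t (interior_subset ht)).differentiableAt.differentiableWithinAt)
      fun t ht => ?_
    rw [(hderiv t (interior_subset ht)).deriv]
    exact hmono _ (hmem t (interior_subset ht))
  exact add_lt_add_of_lt_of_le hlt
    (hψmono (left_mem_Icc.2 hlt.le) (right_mem_Icc.2 hlt.le) hlt.le)

theorem injOn_slide (hψ : DifferentiableOn ℝ ψ (U3 a b \ ray3))
    (hmono : ∀ p ∈ U3 a b \ ray3, 0 ≤ fderiv ℝ ψ p (1, 0, 0)) :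
    InjOn (slide ψ) (U3 a b \ ray3) := by
  rintro ⟨x, w⟩ hp ⟨x', w'⟩ hp' h
  obtain rfl : w = w' := congrArg Prod.snd h
  rcases lt_trichotomy x x' with hlt | rfl | hlt
  · exact absurd (congrArg Prod.fst h) (slide_fst_lt_of_lt hψ hmono hp hp' hlt).ne
  · rfl
  · exact absurd (congrArg Prod.fst h) (slide_fst_lt_of_lt hψ hmono hp' hp hlt).ne'

theorem mapsTo_slide (hnonneg : ∀ p ∈ U3 a b \ ray3, 0 ≤ ψ p) :
    MapsTo (slide ψ) (U3 a b \ ray3) (U3 a b) := fun p hp =>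
  ⟨lt_of_lt_of_le hp.1.1 (le_add_of_nonneg_right (hnonneg p hp)), hp.1.2⟩

theorem surjOn_slide {c : ℝ} (hc : 0 < c) (hcb : c < b)
    (hψ : ContinuousOn ψ (U3 a b \ ray3)) (hnonneg : ∀ p ∈ U3 a b \ ray3, 0 ≤ ψ p)
    (hsupp : ∀ p ∈ U3 a b \ ray3, p ∉ V3 c → ψ p = 0)
    (hblowup : ∀ p : ℕ → ℝ × ℝ × ℝ, (∀ k, p k ∈ U3 a b \ ray3) →
      ∀ q ∈ ray3, Tendsto p atTop (𝓝 q) → Tendsto (fun k => ψ (p k)) atTop atTop) :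
    SurjOn (slide ψ) (U3 a b \ ray3) (U3 a b) := by
  rintro ⟨u, w⟩ hq
  have hleft : ∀ x : ℝ, -b < x → x < 0 → (x, w) ∈ U3 a b \ ray3 := fun x hbx hx =>
    ⟨⟨hbx, hq.2⟩, fun hr => absurd hr.1 hx.not_ge⟩
  have hzero : ∀ x : ℝ, -b < x → x ≤ -c → ψ (x, w) = 0 := fun x hbx hx =>
    hsupp _ (hleft x hbx (by linarith)) fun hV => absurd hV.1 hx.not_gt
  rcases le_or_gt u (-c) with huc | huc
  · refine ⟨(u, w), hleft u hq.1 (by linarith), ?_⟩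
    ext <;> simp [slide, hzero u hq.1 huc]
  obtain ⟨x₁, hcx₁, hx₁, hux₁⟩ : ∃ x₁, -c ≤ x₁ ∧ (x₁, w) ∈ U3 a b \ ray3 ∧
      u ≤ x₁ + ψ (x₁, w) := by
    by_cases hr : (u, w) ∈ ray3
    · have hx : ∀ k : ℕ, -c ≤ -c * (1 / ((k : ℝ) + 1)) ∧ -c * (1 / ((k : ℝ) + 1)) < 0 := by
        intro k
        have h1 : 0 < 1 / ((k : ℝ) + 1) := by positivity
        have h2 : 1 / ((k : ℝ) + 1) ≤ 1 := by
          rw [div_le_one (by positivity)]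
          linarith [k.cast_nonneg (α := ℝ)]
        constructor <;> nlinarith
      have hmem : ∀ k : ℕ, (-c * (1 / ((k : ℝ) + 1)), w) ∈ U3 a b \ ray3 := fun k =>
        hleft _ (by linarith [(hx k).1]) (hx k).2
      have hlim : Tendsto (fun k : ℕ => (-c * (1 / ((k : ℝ) + 1)), w)) atTop (𝓝 (0, w)) := by
        refine Tendsto.prodMk_nhds ?_ tendsto_const_nhds
        simpa using (tendsto_one_div_add_atTop_nhds_zero_nat (𝕜 := ℝ)).const_mul (-c)
      obtain ⟨k, hk⟩ := ((hblowup _ hmem (0, w) ⟨le_rfl, hr.2⟩ hlim).eventually_ge_atTop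
        (u + c)).exists
      exact ⟨_, (hx k).1, hmem k, by linarith [(hx k).1]⟩
    · exact ⟨u, huc.le, ⟨hq, hr⟩, le_add_of_nonneg_right (hnonneg _ ⟨hq, hr⟩)⟩
  have hmem : ∀ x ∈ Icc (-c) x₁, (x, w) ∈ U3 a b \ ray3 := fun x hx =>
    mem_U3_diff_ray3_of_le hx₁ (by linarith [hx.1]) hx.2
  have hcont : ContinuousOn (fun x => x + ψ (x, w)) (Icc (-c) x₁) :=
    continuousOn_id.add (hψ.comp (by fun_prop) hmem)
  obtain ⟨x, hx, hxu⟩ := intermediate_value_Icc hcx₁ hcont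
    ⟨by rw [hzero (-c) (by linarith) le_rfl]; linarith, hux₁⟩
  exact ⟨(x, w), hmem x hx, Prod.ext hxu rfl⟩

end Slide

/-- Let `a, b, c > 0` with `a > c`, `b > c`, and let `ψ` be a smooth
nonnegative function on `U ∖ l`, vanishing outside `V`, nondecreasing in the
`x`-direction, and blowing up along the removed ray `l`.  Then
`G(x, y, z) = (x + ψ(x, y, z), y, z)` is a bijection from `U ∖ l` onto `U`, is smooth,
and has a smooth inverse; in particular it is a diffeomorphism from `U ∖ l` onto `U`
preserving the last two coordinates and equal to the identity on `U ∖ V`. -/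
theorem sliding_map_is_diffeomorphism
    (a b c : ℝ) (ha : 0 < a) (hb : 0 < b) (hc : 0 < c) (hca : c < a) (hcb : c < b)
    (ψ : ℝ × ℝ × ℝ → ℝ)
    (hψ_smooth : ContDiffOn ℝ (⊤ : ℕ∞) ψ (U3 a b \ ray3))
    (hψ_nonneg : ∀ p ∈ U3 a b \ ray3, 0 ≤ ψ p)
    (hψ_supp : ∀ p ∈ U3 a b \ ray3, p ∉ V3 c → ψ p = 0)
    (hψ_mono : ∀ p ∈ U3 a b \ ray3, 0 ≤ fderiv ℝ ψ p (1, 0, 0))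
    (hψ_blowup : ∀ p : ℕ → ℝ × ℝ × ℝ, (∀ k, p k ∈ U3 a b \ ray3) →
      ∀ q ∈ ray3, Filter.Tendsto p Filter.atTop (nhds q) →
        Filter.Tendsto (fun k => ψ (p k)) Filter.atTop Filter.atTop) :
    Set.BijOn (slide ψ) (U3 a b \ ray3) (U3 a b) ∧
    ContDiffOn ℝ (⊤ : ℕ∞) (slide ψ) (U3 a b \ ray3) ∧
    (∃ G' : ℝ × ℝ × ℝ → ℝ × ℝ × ℝ,
      ContDiffOn ℝ (⊤ : ℕ∞) G' (U3 a b) ∧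
      (∀ p ∈ U3 a b \ ray3, G' (slide ψ p) = p) ∧
      (∀ q ∈ U3 a b, slide ψ (G' q) = q)) ∧
    (∀ p ∈ U3 a b \ ray3, (slide ψ p).2.1 = p.2.1 ∧ (slide ψ p).2.2 = p.2.2) ∧
    (∀ p ∈ U3 a b \ V3 c, slide ψ p = p) := by
  have hopen := isOpen_U3_diff_ray3 a b
  have hdiff : DifferentiableOn ℝ ψ (U3 a b \ ray3) := hψ_smooth.differentiableOn (by simp)
  have hslide : ContDiffOn ℝ (⊤ : ℕ∞) (slide ψ) (U3 a b \ ray3) :=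
    (contDiffOn_fst.add hψ_smooth).prodMk contDiffOn_snd
  have hbij : BijOn (slide ψ) (U3 a b \ ray3) (U3 a b) :=
    ⟨mapsTo_slide hψ_nonneg, injOn_slide hdiff hψ_mono,
      surjOn_slide hc hcb hψ_smooth.continuousOn hψ_nonneg hψ_supp hψ_blowup⟩
  have hinv := hbij.invOn_invFunOn
  refine ⟨hbij, hslide, ⟨Function.invFunOn (slide ψ) (U3 a b \ ray3), ?_, hinv.1, hinv.2⟩,
    fun p _ => ⟨rfl, rfl⟩, fun p hp => ?_⟩
  · exact contDiffOn_of_leftInvOn_of_injective_fderiv (by simp) hopen hslide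
      hbij.surjOn.mapsTo_invFunOn hinv.2 hinv.1 fun p hp =>
        injective_fderiv_slide (hdiff.differentiableAt (hopen.mem_nhds hp)) (hψ_mono p hp)
  · have hψp : ψ p = 0 := hψ_supp p ⟨hp.1, fun hr => hp.2 (ray3_subset_V3 hc hr)⟩ hp.2
    simp [slide, hψp]
end
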